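/- arXiv:2105.01420 — 5 statements merged into one kernel-verified Lean document; each statement's English description precedes it below -/
import Mathlib

section
/- (Theorem 1, forward direction.) Fix integers M, d, m ≥ 1 and scalars a, b, c ∈ ℝ. For any multi-level quantized two-layer network f(x) = Σ_{j=1}^m σ(x^T q_j) α_j with q_j ∈ Q_M^d and α_j ∈ ℝ, where σ(t) = at^2 + bt + c, there exist an integer m′ and binary vectors u_j, v_j ∈ {-1,+1}^{dM+1} and scalars α′_j ∈ ℝ, j = 1,...,m′, such that for all x ∈ ℝ^d, f(x) = Σ_{j=1}^{m′} u_j^T 𝒳(x) v_j α′_j, where 𝒳(x) := [[a·x̃x̃^T, (b/2)x̃], [(b/2)x̃^T, c]] ∈ ℝ^{(dM+1)×(dM+1)} and x̃ := x ⊗ 1_M is the coordinate-replicated vector. -/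
open Matrix

/-- The lifted data matrix `𝒳(x) = [[a·x̃x̃ᵀ, (b/2)x̃], [(b/2)x̃ᵀ, c]]` of size
`(dM+1) × (dM+1)`, where `x̃ = x ⊗ 1_M` is the coordinate-replicated vector,
indexed by `(i, k) ∈ Fin d × Fin M` with `x̃ (i, k) = x i`. -/
noncomputable def liftedReplicatedMatrix {d M : ℕ} (a b c : ℝ) (x : Fin d → ℝ) :
    Matrix ((Fin d × Fin M) ⊕ Unit) ((Fin d × Fin M) ⊕ Unit) ℝ :=
  Matrix.fromBlocks
    (a • Matrix.vecMulVec (fun p : Fin d × Fin M => x p.1)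
      (fun p : Fin d × Fin M => x p.1))
    (Matrix.of fun (i : Fin d × Fin M) _ => (b / 2) * x i.1)
    (Matrix.of fun _ (j : Fin d × Fin M) => (b / 2) * x j.1)
    (Matrix.of fun _ _ => c)

/-- Every integer in `{-M, -M+2, ..., M}` is a sum of `M` signs. -/
theorem exists_signs_sum_eq (M : ℕ) (t : ℤ) (hl : -(M : ℤ) ≤ t) (hu : t ≤ M)
    (hdvd : (2 : ℤ) ∣ t - M) :
    ∃ s : Fin M → ℝ, (∀ k, s k = 1 ∨ s k = -1) ∧ ∑ k, s k = t := by
  induction M generalizing t with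
  | zero => exact ⟨0, fun k => k.elim0, by simp; norm_cast; omega⟩
  | succ M ih =>
    push_cast at hl hu hdvd
    by_cases h : t = -(M + 1 : ℤ)
    · obtain ⟨s, hs, hsum⟩ := ih (t + 1) (by omega) (by omega) (by omega)
      refine ⟨Fin.cons (-1) s, Fin.cases (by simp) (by simpa using hs), ?_⟩
      simp [Fin.sum_univ_succ, hsum]
    · obtain ⟨s, hs, hsum⟩ := ih (t - 1) (by omega) (by omega) (by omega)
      refine ⟨Fin.cons 1 s, Fin.cases (by simp) (by simpa using hs), ?_⟩
      simp [Fin.sum_univ_succ, hsum]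

/-- The quadratic form of the lifted matrix at `(s, 1)` is the activation `at² + bt + c`
evaluated at the inner product `t` of `s` with the replicated input. -/
theorem dotProduct_liftedReplicatedMatrix_mulVec_elim_one {d M : ℕ} (a b c : ℝ)
    (x : Fin d → ℝ) (s : Fin d × Fin M → ℝ) :
    Sum.elim s (1 : Unit → ℝ) ⬝ᵥ liftedReplicatedMatrix a b c x *ᵥ Sum.elim s 1
      = a * (∑ p, x p.1 * s p) ^ 2 + b * (∑ p, x p.1 * s p) + c := by
  have hcol : s ⬝ᵥ (Matrix.of fun (i : Fin d × Fin M) (_ : Unit) => (b / 2) * x i.1) *ᵥ 1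
      = b / 2 * ∑ p, x p.1 * s p := by
    simp only [dotProduct, mulVec, Finset.mul_sum]
    refine Finset.sum_congr rfl fun p _ => ?_
    simp
    ring
  have hrow : (1 : Unit → ℝ) ⬝ᵥ
      (Matrix.of fun (_ : Unit) (j : Fin d × Fin M) => (b / 2) * x j.1) *ᵥ s
      = b / 2 * ∑ p, x p.1 * s p := by
    simp [dotProduct, mulVec, Finset.mul_sum, mul_assoc]
  have hquad : s ⬝ᵥ (a • vecMulVec (fun p : Fin d × Fin M => x p.1) (fun p => x p.1)) *ᵥ s
      = a * (∑ p, x p.1 * s p) ^ 2 := by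
    rw [smul_mulVec, vecMulVec_mulVec, dotProduct_smul, dotProduct_smul, dotProduct_comm s]
    simp [dotProduct, sq]
  have hconst : (1 : Unit → ℝ) ⬝ᵥ (Matrix.of fun (_ _ : Unit) => c) *ᵥ 1 = c := by
    simp [dotProduct, mulVec]
  rw [liftedReplicatedMatrix, fromBlocks_mulVec, sumElim_dotProduct_sumElim,
    Sum.elim_comp_inl, Sum.elim_comp_inr, dotProduct_add, dotProduct_add,
    hquad, hcol, hrow, hconst]
  ring

/-- Theorem 1, forward direction: a multi-level `(M+1)`-level quantized
two-layer network with polynomial activation `σ(t) = at² + bt + c`,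
`f(x) = ∑_j σ(xᵀ q_j) α_j` with `q_j ∈ Q_M^d`, can be represented as a binary
quantized bilinear activation network `∑_j u_jᵀ 𝒳(x) v_j α'_j` with
`u_j, v_j ∈ {-1,+1}^{dM+1}`. -/
theorem multilevel_poly_net_as_binary_bilinear_net (M d m : ℕ)
    (hM : 1 ≤ M) (hd : 1 ≤ d) (hm : 1 ≤ m) (a b c : ℝ)
    (q : Fin m → Fin d → ℤ)
    (hq : ∀ j i, -(M : ℤ) ≤ q j i ∧ q j i ≤ (M : ℤ) ∧ (2 : ℤ) ∣ (q j i - (M : ℤ)))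
    (α : Fin m → ℝ) :
    ∃ (m' : ℕ) (u v : Fin m' → ((Fin d × Fin M) ⊕ Unit) → ℝ) (α' : Fin m' → ℝ),
      (∀ j i, u j i = 1 ∨ u j i = -1) ∧ (∀ j i, v j i = 1 ∨ v j i = -1) ∧
      ∀ x : Fin d → ℝ,
        ∑ j, (a * (∑ i, x i * (q j i : ℝ)) ^ 2
                + b * (∑ i, x i * (q j i : ℝ)) + c) * α j
          = ∑ j, (u j ⬝ᵥ (liftedReplicatedMatrix a b c x) *ᵥ v j) * α' j := by
  choose s hs hsum using fun j i =>
    exists_signs_sum_eq M (q j i) (hq j i).1 (hq j i).2.1 (hq j i).2.2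
  let u : Fin m → ((Fin d × Fin M) ⊕ Unit) → ℝ := fun j => Sum.elim (fun p => s j p.1 p.2) 1
  have hu : ∀ j i, u j i = 1 ∨ u j i = -1 := by
    rintro j (p | _)
    · exact hs j p.1 p.2
    · exact Or.inl rfl
  refine ⟨m, u, u, α, hu, hu, fun x => Finset.sum_congr rfl fun j _ => ?_⟩
  rw [dotProduct_liftedReplicatedMatrix_mulVec_elim_one]
  simp only [Fintype.sum_prod_type, ← Finset.mul_sum, hsum]
end

section
/- (SDP lower bound d_SDP ≤ p*, quadratic activation.) Let ℓ : ℝ^n → ℝ, β ≥ 0, and x_1,...,x_n ∈ ℝ^d. For any u_1,...,u_m ∈ {-1,+1}^d and α_1,...,α_m ∈ ℝ, define Z_1 := Σ_{j: α_j ≥ 0} α_j u_j u_j^T, Z_2 := Σ_{j: α_j < 0} (−α_j) u_j u_j^T, ρ_1 := Σ_{j: α_j ≥ 0} α_j, and ρ_2 := Σ_{j: α_j < 0} (−α_j). Then (i) Z_1 ⪰ 0 and Z_2 ⪰ 0; (ii) every diagonal entry of Z_1 equals ρ_1 and every diagonal entry of Z_2 equals ρ_2; (iii) x_i^T (Z_1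 − Z_2) x_i = Σ_{j=1}^m α_j (x_i^T u_j)^2 for all i; and (iv) ℓ(ŷ) + βd(ρ_1 + ρ_2) equals the primal objective ℓ(Σ_j σ(Xu_j)α_j) + βd Σ_j |α_j| with σ(t) = t^2, where ŷ_i = x_i^T(Z_1 − Z_2)x_i. Hence every primal-feasible point of the non-convex quadratic-activation training problem yields a feasible point of the SDP with equal objective, so the SDP optimal value lower-bounds p*. -/
open Matrix

namespace Matrix

variable {ι κ : Type*}

theorem posSemidef_sum_smul_vecMulVec_self [Finite κ] (s : Finset ι) (a : ι → ℝ)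
    (ha : ∀ j ∈ s, 0 ≤ a j) (u : ι → κ → ℝ) :
    (∑ j ∈ s, a j • vecMulVec (u j) (u j)).PosSemidef :=
  posSemidef_sum s fun j hj =>
    (by simpa using posSemidef_vecMulVec_self_star (u j) :
      (vecMulVec (u j) (u j)).PosSemidef).smul (ha j hj)

theorem sum_smul_vecMulVec_self_diag (s : Finset ι) (a : ι → ℝ) (u : ι → κ → ℝ)
    (hu : ∀ j i, u j i = 1 ∨ u j i = -1) (i : κ) :
    (∑ j ∈ s, a j • vecMulVec (u j) (u j)) i i = ∑ j ∈ s, a j := by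
  rw [sum_apply]
  refine Finset.sum_congr rfl fun j _ => ?_
  rcases hu j i with h | h <;> simp [vecMulVec_apply, h]

theorem dotProduct_sum_smul_vecMulVec_self_mulVec [Fintype κ] (s : Finset ι) (a : ι → ℝ)
    (u : ι → κ → ℝ) (v : κ → ℝ) :
    v ⬝ᵥ (∑ j ∈ s, a j • vecMulVec (u j) (u j)) *ᵥ v = ∑ j ∈ s, a j * (v ⬝ᵥ u j) ^ 2 := by
  rw [sum_mulVec, dotProduct_sum]
  refine Finset.sum_congr rfl fun j _ => ?_
  rw [smul_mulVec, vecMulVec_mulVec, dotProduct_smul, dotProduct_smul, dotProduct_comm (u j) v]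
  simp [sq]

end Matrix

theorem Finset.sum_filter_nonneg_sub_sum_filter_neg {ι : Type*} [Fintype ι] (α f : ι → ℝ) :
    ∑ j ∈ univ.filter (fun j => 0 ≤ α j), α j * f j -
      ∑ j ∈ univ.filter (fun j => α j < 0), -α j * f j = ∑ j, α j * f j := by
  rw [← sum_filter_add_sum_filter_not univ (fun j => 0 ≤ α j) fun j => α j * f j]
  simp [sum_neg_distrib]

theorem Finset.sum_filter_nonneg_add_sum_filter_neg {ι : Type*} [Fintype ι] (α : ι → ℝ) :
    ∑ j ∈ univ.filter (fun j => 0 ≤ α j), α j +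
      ∑ j ∈ univ.filter (fun j => α j < 0), -α j = ∑ j, |α j| := by
  rw [← sum_filter_add_sum_filter_not univ (fun j => 0 ≤ α j) fun j => |α j|]
  simp only [not_le]
  congr 1
  · exact sum_congr rfl fun j hj => (abs_of_nonneg (mem_filter.1 hj).2).symm
  · exact sum_congr rfl fun j hj => (abs_of_neg (mem_filter.1 hj).2).symm

/-- SDP lower bound `d_SDP ≤ p*` for quadratic activation: every
primal-feasible point of the non-convex quadratic-activation training
problem yields a feasible point `(Z₁, Z₂, ρ₁, ρ₂)` of the SDP with equal
objective value. -/
theorem sdp_feasible_from_primal_quadratic {n d m : ℕ}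
    (ℓ : (Fin n → ℝ) → ℝ) (β : ℝ) (hβ : 0 ≤ β)
    (x : Fin n → Fin d → ℝ)
    (u : Fin m → Fin d → ℝ) (hu : ∀ j i, u j i = 1 ∨ u j i = -1)
    (α : Fin m → ℝ) :
    let Z₁ : Matrix (Fin d) (Fin d) ℝ :=
      ∑ j ∈ Finset.univ.filter (fun j => 0 ≤ α j),
        α j • Matrix.vecMulVec (u j) (u j)
    let Z₂ : Matrix (Fin d) (Fin d) ℝ :=
      ∑ j ∈ Finset.univ.filter (fun j => α j < 0),
        (-α j) • Matrix.vecMulVec (u j) (u j)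
    let ρ₁ : ℝ := ∑ j ∈ Finset.univ.filter (fun j => 0 ≤ α j), α j
    let ρ₂ : ℝ := ∑ j ∈ Finset.univ.filter (fun j => α j < 0), (-α j)
    Z₁.PosSemidef ∧ Z₂.PosSemidef ∧
    (∀ i, Z₁ i i = ρ₁) ∧ (∀ i, Z₂ i i = ρ₂) ∧
    (∀ i, x i ⬝ᵥ (Z₁ - Z₂) *ᵥ x i = ∑ j, α j * (x i ⬝ᵥ u j) ^ 2) ∧
    ℓ (fun i => x i ⬝ᵥ (Z₁ - Z₂) *ᵥ x i) + β * d * (ρ₁ + ρ₂) =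
      ℓ (fun i => ∑ j, (x i ⬝ᵥ u j) ^ 2 * α j) + β * d * ∑ j, |α j| := by
  intro Z₁ Z₂ ρ₁ ρ₂
  have hquad (i : Fin n) :
      x i ⬝ᵥ (Z₁ - Z₂) *ᵥ x i = ∑ j, α j * (x i ⬝ᵥ u j) ^ 2 := by
    rw [sub_mulVec, dotProduct_sub, dotProduct_sum_smul_vecMulVec_self_mulVec,
      dotProduct_sum_smul_vecMulVec_self_mulVec, Finset.sum_filter_nonneg_sub_sum_filter_neg]
  refine ⟨posSemidef_sum_smul_vecMulVec_self _ _ (fun j hj => (Finset.mem_filter.1 hj).2) _,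
    posSemidef_sum_smul_vecMulVec_self _ _
      (fun j hj => neg_nonneg.2 (Finset.mem_filter.1 hj).2.le) _,
    sum_smul_vecMulVec_self_diag _ _ _ hu, sum_smul_vecMulVec_self_diag _ _ _ hu, hquad, ?_⟩
  have hρ : ρ₁ + ρ₂ = ∑ j, |α j| := Finset.sum_filter_nonneg_add_sum_filter_neg α
  simp only [hquad, hρ, mul_comm (α _)]
end

section
/- (SDP lower bound d_bSDP ≤ p_b*, bilinear activation.) Let ℓ : ℝ^n → ℝ, β ≥ 0, and x_1,...,x_n ∈ ℝ^d. For any u_1,...,u_m, v_1,...,v_m ∈ {-1,+1}^d and α_1,...,α_m ∈ ℝ, define s_j := sign(α_j) ∈ {-1,+1} (take s_j = 1 if α_j = 0), Q := Σ_{j=1}^m (|α_j|/2) [u_j; s_j v_j][u_j; s_j v_j]^T ∈ ℝ^{2d×2d}, and ρ := Σ_{j=1}^m |α_j| / 2. Then (i) Q ⪰ 0; (ii) every diagonal entry of Q equals ρ; (iii) the upper-right d×d block Z of Q satisfies 2 x_i^T Z x_i = Σ_{j=1}^m α_j (x_i^T u_j)(x_i^T v_j) for all i; and (iv) ℓ(ŷ)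 + βdρ ≤ ℓ(Σ_j ((Xu_j)∘(Xv_j))α_j) + βd Σ_j |α_j|, where ŷ_i = 2x_i^T Z x_i. Hence the optimal value d_bSDP of the bilinear SDP lower-bounds the optimal value p_b* of the non-convex bilinear training problem. -/
open Matrix

theorem dotProduct_sum_smul_vecMulVec_mulVec {ι κ : Type*} [Fintype ι] [Fintype κ]
    (c : κ → ℝ) (a b : κ → ι → ℝ) (x : ι → ℝ) :
    x ⬝ᵥ (∑ j, c j • vecMulVec (a j) (b j)) *ᵥ x =
      ∑ j, c j * (x ⬝ᵥ a j) * (x ⬝ᵥ b j) := by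
  rw [sum_mulVec, dotProduct_sum]
  refine Finset.sum_congr rfl fun j _ => ?_
  rw [smul_mulVec, vecMulVec_mulVec, dotProduct_smul, op_smul_eq_smul, dotProduct_smul,
    dotProduct_comm (b j) x]
  simp only [smul_eq_mul]
  ring

/-- SDP lower bound `d_bSDP ≤ p_b*` for bilinear activation: every
primal-feasible point of the non-convex bilinear training problem yields a
feasible point `(Q, ρ)` of the bilinear SDP whose objective is no larger. -/
theorem sdp_feasible_from_primal_bilinear {n d m : ℕ}
    (ℓ : (Fin n → ℝ) → ℝ) (β : ℝ) (hβ : 0 ≤ β)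
    (x : Fin n → Fin d → ℝ)
    (u v : Fin m → Fin d → ℝ)
    (hu : ∀ j i, u j i = 1 ∨ u j i = -1)
    (hv : ∀ j i, v j i = 1 ∨ v j i = -1)
    (α : Fin m → ℝ) :
    let s : Fin m → ℝ := fun j => if α j < 0 then -1 else 1
    let Q : Matrix (Fin d ⊕ Fin d) (Fin d ⊕ Fin d) ℝ :=
      ∑ j, (|α j| / 2) •
        Matrix.vecMulVec (Sum.elim (u j) (fun i => s j * v j i))
          (Sum.elim (u j) (fun i => s j * v j i))
    let ρ : ℝ := (∑ j, |α j|) / 2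
    Q.PosSemidef ∧
    (∀ i, Q i i = ρ) ∧
    (∀ i, 2 * (x i ⬝ᵥ (Matrix.of fun a b : Fin d =>
        Q (Sum.inl a) (Sum.inr b)) *ᵥ x i) =
      ∑ j, α j * (x i ⬝ᵥ u j) * (x i ⬝ᵥ v j)) ∧
    ℓ (fun i => 2 * (x i ⬝ᵥ (Matrix.of fun a b : Fin d =>
        Q (Sum.inl a) (Sum.inr b)) *ᵥ x i)) + β * d * ρ ≤
      ℓ (fun i => ∑ j, ((x i ⬝ᵥ u j) * (x i ⬝ᵥ v j)) * α j) +
        β * d * ∑ j, |α j| := by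
  intro s Q ρ
  have abs_mul_s : ∀ j, |α j| * s j = α j := fun j => by
    by_cases h : α j < 0
    · simp [s, h, abs_of_neg h]
    · simp [s, h, abs_of_nonneg (not_lt.mp h)]
  have s_sq : ∀ j, s j * s j = 1 := fun j => by
    by_cases h : α j < 0 <;> simp [s, h]
  have u_sq : ∀ j i, u j i * u j i = 1 := fun j i => by
    rcases hu j i with h | h <;> simp [h]
  have v_sq : ∀ j i, v j i * v j i = 1 := fun j i => by
    rcases hv j i with h | h <;> simp [h]
  have offDiag : (Matrix.of fun a b : Fin d => Q (Sum.inl a) (Sum.inr b)) =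
      ∑ j, (α j / 2) • vecMulVec (u j) (v j) := by
    ext a b
    simp only [Q, of_apply, Matrix.sum_apply, Matrix.smul_apply, vecMulVec_apply, Sum.elim_inl,
      Sum.elim_inr, smul_eq_mul]
    refine Finset.sum_congr rfl fun j _ => ?_
    linear_combination (u j a * v j b / 2) * abs_mul_s j
  have predictions : ∀ i, 2 * (x i ⬝ᵥ (Matrix.of fun a b : Fin d =>
      Q (Sum.inl a) (Sum.inr b)) *ᵥ x i) = ∑ j, α j * (x i ⬝ᵥ u j) * (x i ⬝ᵥ v j) := by
    intro i
    rw [offDiag, dotProduct_sum_smul_vecMulVec_mulVec, Finset.mul_sum]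
    exact Finset.sum_congr rfl fun j _ => by ring
  refine ⟨?_, ?_, predictions, ?_⟩
  · refine posSemidef_sum _ fun j _ => PosSemidef.smul ?_ (by positivity)
    simpa using posSemidef_vecMulVec_self_star (Sum.elim (u j) fun i => s j * v j i)
  · intro i
    simp only [Q, ρ, Matrix.sum_apply, Matrix.smul_apply, vecMulVec_apply, smul_eq_mul,
      Finset.sum_div]
    refine Finset.sum_congr rfl fun j _ => ?_
    rcases i with i | i
    · simp [u_sq]
    · rw [Sum.elim_inr, mul_mul_mul_comm (s j), s_sq, v_sq, one_mul, mul_one]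
  · have hρ : ρ ≤ ∑ j, |α j| := half_le_self (Finset.sum_nonneg fun j _ => abs_nonneg _)
    have h_pred : (fun i => 2 * (x i ⬝ᵥ (Matrix.of fun a b : Fin d =>
        Q (Sum.inl a) (Sum.inr b)) *ᵥ x i)) =
        fun i => ∑ j, ((x i ⬝ᵥ u j) * (x i ⬝ᵥ v j)) * α j := by
      funext i
      rw [predictions]
      exact Finset.sum_congr rfl fun j _ => by ring
    rw [h_pred]
    gcongr
end

section
/- (Theorem 2, trigonometric covariance shaping.) Let Z* ∈ ℝ^{d×d} be a matrix such that there exist V, W ∈ ℝ^{d×d} making the block matrix [[V, Z*],[Z*^T, W]] positive semidefinite with V_{jj} = W_{jj} = 1 for all j. Let γ = ln(1+√2). Then there exists a positive semidefinite matrix Q ∈ ℝ^{2d×2d} with Q_{jj} = 1 for all j = 1,...,2d such that the entrywise inverse sine of the upper-right d×d block Q_{(12)} of Q satisfies arcsin(Q_{(12)}) = γ Z*, i.e., arcsin((Q_{(12)})_{ij}) = γ Z*_{ij} for all i, j. -/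
open Matrix

/-- An entrywise convergent series of positive semidefinite real matrices has positive
semidefinite sum. -/
theorem Matrix.PosSemidef.of_hasSum_apply {ι κ : Type*} [Fintype ι] {A : κ → Matrix ι ι ℝ}
    {B : Matrix ι ι ℝ} (hA : ∀ k, (A k).PosSemidef)
    (hB : ∀ i j, HasSum (fun k => A k i j) (B i j)) : B.PosSemidef := by
  refine Matrix.PosSemidef.of_dotProduct_mulVec_nonneg ?_ fun x => ?_
  · ext i j
    refine (hB j i).unique ?_
    convert! hB i j using 2 with k
    exact (hA k).isHermitian.apply i j
  · have h : HasSum (fun k => star x ⬝ᵥ (A k *ᵥ x)) (star x ⬝ᵥ (B *ᵥ x)) :=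
      hasSum_sum fun i _ => (hasSum_sum fun j _ => (hB i j).mul_right (x j)).mul_left (star x i)
    exact h.nonneg fun k => (hA k).dotProduct_mulVec_nonneg x

/-- Entrywise natural powers of a positive semidefinite matrix are positive semidefinite. -/
theorem Matrix.PosSemidef.map_pow {ι : Type*} [Fintype ι] {A : Matrix ι ι ℝ}
    (hA : A.PosSemidef) (n : ℕ) : (A.map (· ^ n)).PosSemidef := by
  induction n with
  | zero =>
    convert! posSemidef_vecMulVec_self_star (fun _ : ι => (1 : ℝ)) using 1
    ext i j
    simp [vecMulVec_apply]
  | succ n ih =>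
    convert! ih.hadamard hA using 1

theorem Matrix.PosSemidef.abs_apply_le_one {ι : Type*} {A : Matrix ι ι ℝ}
    (hA : A.PosSemidef) (h1 : ∀ i, A i i = 1) (i j : ι) : |A i j| ≤ 1 := by
  have h := (hA.submatrix ![i, j]).det_nonneg
  have hs : A j i = A i j := hA.isHermitian.apply i j
  simp only [det_fin_two, submatrix_apply, cons_val_zero, cons_val_one, h1, hs] at h
  exact abs_le_one_iff_mul_self_le_one.mpr (by linarith)

theorem Real.sinh_log_one_add_sqrt_two : Real.sinh (Real.log (1 + √2)) = 1 := by
  have h2 : √2 * √2 = 2 := Real.mul_self_sqrt (by norm_num)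
  rw [Real.sinh_log (by positivity)]
  field_simp
  linarith

/-- Applying `sinh` to the diagonal blocks and `sin` to the off-diagonal blocks of a positive
semidefinite matrix preserves positive semidefiniteness. -/
theorem Matrix.PosSemidef.fromBlocks_sinh_sin {m n : Type*} [Fintype m] [Fintype n]
    {A : Matrix m m ℝ} {B : Matrix m n ℝ} {C : Matrix n m ℝ} {D : Matrix n n ℝ}
    (h : (fromBlocks A B C D).PosSemidef) :
    (fromBlocks (A.map Real.sinh) (B.map Real.sin) (C.map Real.sin)
      (D.map Real.sinh)).PosSemidef := by
  let s : m ⊕ n → ℝ := Sum.elim (fun _ => 1) fun _ => -1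
  refine Matrix.PosSemidef.of_hasSum_apply
    (fun k : ℕ => (((posSemidef_vecMulVec_self_star s).map_pow k).hadamard
      (h.map_pow (2 * k + 1))).smul (inv_nonneg.mpr (Nat.cast_nonneg (α := ℝ) (2 * k + 1).factorial))) ?_
  rintro (i | i) (j | j)
  · convert! Real.hasSum_sinh (A i j) using 2 with k
    simp [s, vecMulVec_apply, div_eq_inv_mul]
  · convert! Real.hasSum_sin (B i j) using 2 with k
    simp [s, vecMulVec_apply, div_eq_inv_mul]
  · convert! Real.hasSum_sin (C i j) using 2 with k
    simp [s, vecMulVec_apply, div_eq_inv_mul]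
  · convert! Real.hasSum_sinh (D i j) using 2 with k
    simp [s, vecMulVec_apply, div_eq_inv_mul]

/-- Theorem 2 (trigonometric covariance shaping).  If `Z*` is the
off-diagonal `d×d` block of some PSD `2d×2d` matrix with unit diagonal,
then there exists a PSD matrix `Q ∈ ℝ^{2d×2d}` with unit diagonal whose
upper-right block `Q_{(12)}` satisfies `arcsin(Q_{(12)}) = γ Z*` entrywise,
where `γ = ln(1+√2)`. -/
theorem trigonometric_covariance_shaping {d : ℕ}
    (Zstar : Matrix (Fin d) (Fin d) ℝ)
    (hZ : ∃ V W : Matrix (Fin d) (Fin d) ℝ,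
      (Matrix.fromBlocks V Zstar Zstarᵀ W).PosSemidef ∧
      (∀ j, V j j = 1) ∧ (∀ j, W j j = 1)) :
    ∃ Q : Matrix (Fin d ⊕ Fin d) (Fin d ⊕ Fin d) ℝ,
      Q.PosSemidef ∧ (∀ j, Q j j = 1) ∧
      ∀ i j : Fin d,
        Real.arcsin (Q (Sum.inl i) (Sum.inr j)) =
          Real.log (1 + Real.sqrt 2) * Zstar i j := by
  obtain ⟨V, W, hM, hV, hW⟩ := hZ
  set γ := Real.log (1 + √2)
  have hsinh : Real.sinh γ = 1 := Real.sinh_log_one_add_sqrt_two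
  have hγ0 : 0 ≤ γ := Real.log_nonneg (by linarith [Real.sqrt_nonneg 2])
  have hγ1 : γ ≤ 1 := hsinh ▸ Real.self_le_sinh_iff.mpr hγ0
  have hγM := hM.smul hγ0
  rw [fromBlocks_smul] at hγM
  refine ⟨_, hγM.fromBlocks_sinh_sin, ?_, fun i j => ?_⟩
  · rintro (j | j) <;> simp [hV, hW, hsinh]
  · have hz : |Zstar i j| ≤ 1 := by
      refine hM.abs_apply_le_one ?_ (Sum.inl i) (Sum.inr j)
      rintro (j | j) <;> simp [hV, hW]
    have hb : |γ * Zstar i j| ≤ 1 := by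
      rw [abs_mul, abs_of_nonneg hγ0]
      exact mul_le_one₀ hγ1 (abs_nonneg _) hz
    obtain ⟨hl, hu⟩ := abs_le.mp hb
    have hpi := Real.pi_gt_three
    simp only [fromBlocks_apply₁₂, map_apply, Matrix.smul_apply, smul_eq_mul]
    exact Real.arcsin_sin (by linarith) (by linarith)
end

section
/- (Grothendieck's identity, two-dimensional case.) Let Z_1, Z_2 be independent standard Gaussian random variables and let ρ ∈ [-1, 1]. Define X := Z_1 and Y := ρ Z_1 + √(1−ρ^2) Z_2, and let sgn(t) equal 1 if t > 0, −1 if t < 0, and 0 if t = 0. Then E[sgn(X) sgn(Y)] = (2/π) arcsin(ρ). -/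
open MeasureTheory ProbabilityTheory

lemma Real.sign_mul_of_pos_left {r : ℝ} (hr : 0 < r) (x : ℝ) :
    Real.sign (r * x) = Real.sign x := by
  rcases lt_trichotomy x 0 with hx | rfl | hx
  · rw [Real.sign_of_neg hx, Real.sign_of_neg (mul_neg_of_pos_of_neg hr hx)]
  · simp
  · rw [Real.sign_of_pos hx, Real.sign_of_pos (mul_pos hr hx)]

lemma Real.measurable_sign : Measurable Real.sign :=
  Measurable.ite measurableSet_Iio measurable_const
    (Measurable.ite measurableSet_Ioi measurable_const measurable_const)

lemma Real.abs_sign_le_one (x : ℝ) : |Real.sign x| ≤ 1 := by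
  rcases Real.sign_apply_eq x with h | h | h <;> simp [h]

lemma intervalIntegrable_sign_cos_mul_sign_sin_add (α a b : ℝ) :
    IntervalIntegrable (fun θ ↦ Real.sign (Real.cos θ) * Real.sign (Real.sin (θ + α)))
      volume a b := by
  refine (intervalIntegrable_const (c := (1 : ℝ))).mono_fun ?_ ?_
  · exact ((Real.measurable_sign.comp (by fun_prop)).mul
      (Real.measurable_sign.comp (by fun_prop))).aestronglyMeasurable
  · refine .of_forall fun θ ↦ ?_
    simp only [norm_mul, norm_one]
    exact mul_le_one₀ (Real.abs_sign_le_one _) (norm_nonneg _) (Real.abs_sign_le_one _)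

lemma periodic_sign_cos_mul_sign_sin_add (α : ℝ) :
    Function.Periodic (fun θ ↦ Real.sign (Real.cos θ) * Real.sign (Real.sin (θ + α)))
      Real.pi := fun θ ↦ by
  simp only [add_right_comm θ Real.pi α, Real.cos_add_pi, Real.sin_add_pi,
    Real.sign_neg, neg_mul_neg]

lemma integral_sign_cos_mul_sign_sin_add {α : ℝ} (h₁ : -(Real.pi / 2) ≤ α)
    (h₂ : α ≤ Real.pi / 2) :
    ∫ θ in Set.Ioo (-Real.pi) Real.pi,
      Real.sign (Real.cos θ) * Real.sign (Real.sin (θ + α)) = 4 * α := by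
  have hint := intervalIntegrable_sign_cos_mul_sign_sin_add α
  have hper := periodic_sign_cos_mul_sign_sin_add α
  have hneg : ∫ θ in -(Real.pi / 2)..-α,
      Real.sign (Real.cos θ) * Real.sign (Real.sin (θ + α)) = α - Real.pi / 2 := by
    rw [intervalIntegral.integral_congr_Ioo_of_le (g := fun _ ↦ (-1 : ℝ)) (by linarith) fun θ hθ ↦ ?_]
    · simp
      ring
    · obtain ⟨hl, hr⟩ := hθ
      simp [Real.sign_of_pos (Real.cos_pos_of_mem_Ioo ⟨hl, by linarith⟩),
        Real.sign_of_neg (Real.sin_neg_of_neg_of_neg_pi_lt (x := θ + α)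
          (by linarith) (by linarith))]
  have hpos : ∫ θ in -α..Real.pi / 2,
      Real.sign (Real.cos θ) * Real.sign (Real.sin (θ + α)) = α + Real.pi / 2 := by
    rw [intervalIntegral.integral_congr_Ioo_of_le (g := fun _ ↦ (1 : ℝ)) (by linarith) fun θ hθ ↦ ?_]
    · simp
      ring
    · obtain ⟨hl, hr⟩ := hθ
      simp [Real.sign_of_pos (Real.cos_pos_of_mem_Ioo ⟨by linarith, hr⟩),
        Real.sign_of_pos (Real.sin_pos_of_pos_of_lt_pi (x := θ + α)
          (by linarith) (by linarith))]
  have hhalf : ∀ t, ∫ θ in t..t + Real.pi,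
      Real.sign (Real.cos θ) * Real.sign (Real.sin (θ + α)) = 2 * α := fun t ↦ by
    rw [hper.intervalIntegral_add_eq t (-(Real.pi / 2)),
      show -(Real.pi / 2) + Real.pi = Real.pi / 2 by ring,
      ← intervalIntegral.integral_add_adjacent_intervals (hint _ (-α)) (hint _ _), hneg, hpos]
    ring
  have hl := hhalf (-Real.pi)
  have hr := hhalf 0
  rw [neg_add_cancel] at hl
  rw [zero_add] at hr
  rw [← integral_Ioc_eq_integral_Ioo,
    ← intervalIntegral.integral_of_le (by linarith [Real.pi_pos]),
    ← intervalIntegral.integral_add_adjacent_intervals (hint _ 0) (hint _ _), hl, hr]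
  ring

lemma integral_Ioi_mul_exp_neg_sq_div_two :
    ∫ r in Set.Ioi (0 : ℝ), r * Real.exp (-r ^ 2 / 2) = 1 := by
  have h := integral_rpow_mul_exp_neg_mul_rpow (p := 2) (q := 1) (b := 1 / 2)
    (by norm_num) (by norm_num) (by norm_num)
  norm_num [Real.rpow_neg_one] at h
  rw [← h]
  congr! 4
  ring

lemma integral_gaussianReal_prod (f : ℝ × ℝ → ℝ) :
    ∫ z, f z ∂((gaussianReal 0 1).prod (gaussianReal 0 1)) =
      (2 * Real.pi)⁻¹ * ∫ z, Real.exp (-(z.1 ^ 2 + z.2 ^ 2) / 2) * f z := by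
  rw [gaussianReal_of_var_ne_zero 0 one_ne_zero,
    prod_withDensity (measurable_gaussianPDF 0 1) (measurable_gaussianPDF 0 1),
    integral_withDensity_eq_integral_toReal_smul (by fun_prop)
      (.of_forall fun _ ↦ ENNReal.mul_lt_top gaussianPDF_lt_top gaussianPDF_lt_top),
    ← integral_const_mul]
  congr 1 with z
  have hs : (√(2 * Real.pi))⁻¹ * (√(2 * Real.pi))⁻¹ = (2 * Real.pi)⁻¹ := by
    rw [← mul_inv, Real.mul_self_sqrt (by positivity)]
  have he : Real.exp (-(z.1 ^ 2 + z.2 ^ 2) / 2) =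
      Real.exp (-z.1 ^ 2 / 2) * Real.exp (-z.2 ^ 2 / 2) := by
    rw [← Real.exp_add]
    ring_nf
  simp only [ENNReal.toReal_mul, toReal_gaussianPDF, gaussianPDFReal, NNReal.coe_one, mul_one,
    sub_zero, smul_eq_mul]
  rw [he, ← hs]
  ring

/-- Grothendieck's identity (two-dimensional case).  If `Z₁, Z₂` are
independent standard Gaussians, `X = Z₁` and `Y = ρ Z₁ + √(1-ρ²) Z₂` with
`ρ ∈ [-1, 1]`, then `E[sgn(X) sgn(Y)] = (2/π) arcsin ρ`, where `sgn` is the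
sign function (`1` on positives, `-1` on negatives, `0` at `0`). -/
theorem grothendieck_identity_two_dim (ρ : ℝ) (hρ : ρ ∈ Set.Icc (-1 : ℝ) 1) :
    ∫ z : ℝ × ℝ, Real.sign z.1 *
        Real.sign (ρ * z.1 + Real.sqrt (1 - ρ ^ 2) * z.2)
      ∂((gaussianReal 0 1).prod (gaussianReal 0 1)) =
      (2 / Real.pi) * Real.arcsin ρ := by
  rw [integral_gaussianReal_prod, ← integral_comp_polarCoord_symm, polarCoord_target,
    setIntegral_congr_fun (g := fun p : ℝ × ℝ ↦ (p.1 * Real.exp (-p.1 ^ 2 / 2)) *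
      (Real.sign (Real.cos p.2) * Real.sign (Real.sin (p.2 + Real.arcsin ρ))))
      (measurableSet_Ioi.prod measurableSet_Ioo) fun p hp ↦ ?_]
  · rw [Measure.volume_eq_prod, setIntegral_prod_mul (fun r : ℝ ↦ r * Real.exp (-r ^ 2 / 2))
        (fun θ : ℝ ↦ Real.sign (Real.cos θ) * Real.sign (Real.sin (θ + Real.arcsin ρ))),
      integral_Ioi_mul_exp_neg_sq_div_two,
      integral_sign_cos_mul_sign_sin_add (Real.neg_pi_div_two_le_arcsin ρ)
        (Real.arcsin_le_pi_div_two ρ)]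
    field_simp
    ring
  · have hr : 0 < p.1 := hp.1
    have hsq : (p.1 * Real.cos p.2) ^ 2 + (p.1 * Real.sin p.2) ^ 2 = p.1 ^ 2 := by
      linear_combination p.1 ^ 2 * Real.sin_sq_add_cos_sq p.2
    have hY : ρ * (p.1 * Real.cos p.2) + √(1 - ρ ^ 2) * (p.1 * Real.sin p.2) =
        p.1 * Real.sin (p.2 + Real.arcsin ρ) := by
      rw [Real.sin_add, Real.sin_arcsin hρ.1 hρ.2, Real.cos_arcsin]
      ring
    simp only [polarCoord_symm_apply, smul_eq_mul, hsq, hY, Real.sign_mul_of_pos_left hr]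
    ring
end
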